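/- Let ε be a standard Gaussian random vector on ℝ^l and, for each m ≥ 2, let z^{(m)} = (D^m)ᵀε where D^m is the size-m LSS dictionary. Then for every m ≥ 2 and every t ∈ ℝ: P( z₂^{(m+1)} ≤ t, z₃^{(m+1)} ≤ t, …, z_{m+1}^{(m+1)} ≤ t ) ≥ P( z₁^{(m)} ≤ t, z₂^{(m)} ≤ t, …, z_m^{(m)} ≤ t ). -/

import Mathlib

open MeasureTheory ProbabilityTheory

lemma aux_integrable_gauss {f : ℝ → ℝ} (hf : Integrable f (gaussianReal 0 1)) :
    Integrable (fun x => gaussianPDFReal 0 1 x * f x) volume := by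
  rw [gaussianReal_of_var_ne_zero 0 one_ne_zero] at hf
  rw [integrable_withDensity_iff_integrable_smul' (measurable_gaussianPDF 0 1)
    (Filter.Eventually.of_forall fun x => gaussianPDF_lt_top)] at hf
  simpa using hf

lemma aux_hasDerivAt_pdf (x : ℝ) :
    HasDerivAt (gaussianPDFReal 0 1) (-x * gaussianPDFReal 0 1 x) x := by
  have h1 : HasDerivAt (fun x : ℝ => -(x - 0) ^ 2 / (2 * ((1 : NNReal) : ℝ))) (-x) x := by
    have := (((hasDerivAt_id x).sub_const 0).pow 2).neg.div_const (2 * ((1 : NNReal) : ℝ))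
    exact this.congr_deriv (by norm_num; ring)
  have := (h1.exp).const_mul (√(2 * Real.pi * ((1 : NNReal) : ℝ)))⁻¹
  rw [gaussianPDFReal_def]
  exact this.congr_deriv (by ring)

lemma aux_stein {g g' : ℝ → ℝ} {C : ℝ} (hg : ∀ x, HasDerivAt g (g' x) x) (hg' : Continuous g')
    (hb : ∀ x, |g x| ≤ C) (hb' : ∀ x, |g' x| ≤ C) :
    ∫ x, x * g x ∂(gaussianReal 0 1) = ∫ x, g' x ∂(gaussianReal 0 1) := by
  have hgc : Continuous g := continuous_iff_continuousAt.2 fun x => (hg x).continuousAt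
  have hid : Integrable (fun x : ℝ => x) (gaussianReal 0 1) :=
    memLp_one_iff_integrable.1 (memLp_id_gaussianReal 1)
  have i1 : Integrable g (gaussianReal 0 1) :=
    Integrable.of_bound hgc.aestronglyMeasurable C (Filter.Eventually.of_forall hb)
  have i2 : Integrable g' (gaussianReal 0 1) :=
    Integrable.of_bound hg'.aestronglyMeasurable C (Filter.Eventually.of_forall hb')
  have i3 : Integrable (fun x => x * g x) (gaussianReal 0 1) :=
    hid.mul_bdd hgc.aestronglyMeasurable (Filter.Eventually.of_forall hb)
  have := integral_mul_deriv_eq_deriv_mul_of_integrable (u := g) (u' := g')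
    (v := gaussianPDFReal 0 1) (v' := fun x => -x * gaussianPDFReal 0 1 x)
    (fun x _ => hg x) (fun x _ => aux_hasDerivAt_pdf x)
    ((aux_integrable_gauss i3).neg.congr (Filter.Eventually.of_forall fun x => by
      simp only [Pi.neg_apply, Pi.mul_apply]; ring))
    ((aux_integrable_gauss i2).congr (Filter.Eventually.of_forall fun x => by
      simp only [Pi.mul_apply]; ring))
    ((aux_integrable_gauss i1).congr (Filter.Eventually.of_forall fun x => by
      simp only [Pi.mul_apply]; ring))
  rw [integral_gaussianReal_eq_integral_smul one_ne_zero,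
    integral_gaussianReal_eq_integral_smul one_ne_zero]
  have e1 : ∫ x, gaussianPDFReal 0 1 x • (x * g x) = - ∫ x, g x * (-x * gaussianPDFReal 0 1 x) := by
    rw [← integral_neg]; congr 1; ext x; simp only [smul_eq_mul]; ring
  rw [e1, this, neg_neg]
  congr 1; ext x; simp only [smul_eq_mul]; ring

lemma aux_resample {ι : Type*} [Fintype ι] [DecidableEq ι] (i : ι) :
    MeasurePreserving (fun p : (ι → ℝ) × ℝ => Function.update p.1 i p.2)
      ((Measure.pi fun _ : ι => gaussianReal 0 1).prod (gaussianReal 0 1))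
      (Measure.pi fun _ : ι => gaussianReal 0 1) := by
  have hm : Measurable (fun p : (ι → ℝ) × ℝ => Function.update p.1 i p.2) := by
    refine measurable_pi_lambda _ fun j => ?_
    by_cases h : j = i
    · subst h; simpa using measurable_snd
    · simp only [Function.update_of_ne h]; fun_prop
  refine ⟨hm, ?_⟩
  refine (Measure.pi_eq fun s hs => ?_).symm
  rw [Measure.map_apply hm (MeasurableSet.univ_pi hs)]
  have : (fun p : (ι → ℝ) × ℝ => Function.update p.1 i p.2) ⁻¹' (Set.univ.pi s)
      = (Set.univ.pi (Function.update s i Set.univ)) ×ˢ (s i) := by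
    ext ⟨x, y⟩
    simp only [Set.mem_preimage, Set.mem_pi, Set.mem_univ, true_imp_iff, Set.mem_prod]
    constructor
    · intro h
      refine ⟨fun j => ?_, by simpa using h i⟩
      by_cases hj : j = i
      · subst hj; simp
      · simpa [Function.update_of_ne hj] using h j
    · rintro ⟨h, h2⟩ j
      by_cases hj : j = i
      · subst hj; simpa
      · simpa [Function.update_of_ne hj] using h j
  rw [this, Measure.prod_prod, Measure.pi_pi, ← Finset.mul_prod_erase _ _ (Finset.mem_univ i),
    ← Finset.mul_prod_erase Finset.univ (fun j => gaussianReal 0 1 (s j)) (Finset.mem_univ i)]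
  simp only [Function.update_self, measure_univ, one_mul]
  rw [mul_comm]
  congr 1
  refine Finset.prod_congr rfl fun j hj => ?_
  rw [Function.update_of_ne (Finset.ne_of_mem_erase hj)]

lemma aux_integrable_coord {ι : Type*} [Fintype ι] (i : ι) :
    Integrable (fun x : ι → ℝ => x i) (Measure.pi fun _ : ι => gaussianReal 0 1) := by
  have hid : Integrable (fun x : ℝ => x) (gaussianReal 0 1) :=
    memLp_one_iff_integrable.1 (memLp_id_gaussianReal 1)
  exact integrable_comp_eval (μ := fun _ : ι => gaussianReal 0 1) hid

lemma aux_ibp {ι : Type*} [Fintype ι] [DecidableEq ι] (i : ι) {G G' : (ι → ℝ) → ℝ} {C : ℝ}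
    (hG : Continuous G) (hG' : Continuous G')
    (hd : ∀ x s, HasDerivAt (fun s => G (Function.update x i s)) (G' (Function.update x i s)) s)
    (hb : ∀ x, |G x| ≤ C) (hb' : ∀ x, |G' x| ≤ C) :
    ∫ x, x i * G x ∂(Measure.pi fun _ : ι => gaussianReal 0 1)
      = ∫ x, G' x ∂(Measure.pi fun _ : ι => gaussianReal 0 1) := by
  have mp := aux_resample (ι := ι) i
  have I1 : Integrable (fun x : ι → ℝ => x i * G x) (Measure.pi fun _ : ι => gaussianReal 0 1) :=
    (aux_integrable_coord i).mul_bdd hG.aestronglyMeasurable (Filter.Eventually.of_forall hb)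
  have I2 : Integrable G' (Measure.pi fun _ : ι => gaussianReal 0 1) :=
    Integrable.of_bound hG'.aestronglyMeasurable C (Filter.Eventually.of_forall hb')
  have key : ∀ f : (ι → ℝ) → ℝ, Integrable f (Measure.pi fun _ : ι => gaussianReal 0 1) →
      ∫ x, f x ∂(Measure.pi fun _ : ι => gaussianReal 0 1)
      = ∫ x, ∫ s, f (Function.update x i s) ∂(gaussianReal 0 1)
        ∂(Measure.pi fun _ : ι => gaussianReal 0 1) := by
    intro f hf
    conv_lhs => rw [← mp.map_eq]
    rw [integral_map mp.measurable.aemeasurable (by rw [mp.map_eq]; exact hf.aestronglyMeasurable)]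
    exact integral_prod _ (mp.integrable_comp_of_integrable hf)
  rw [key _ I1, key _ I2]
  congr 1; ext x
  simp only [Function.update_self]
  exact aux_stein (hd x) (hG'.comp (continuous_const.update i continuous_id))
    (fun s => hb _) (fun s => hb' _)
section Smooth
set_option linter.unusedSectionVars false
variable {κ ι : Type*} [Fintype κ] [DecidableEq κ] [Fintype ι] [DecidableEq ι]

/-- first partial derivatives of the product function -/
noncomputable def auxU (φ φ1 : ℝ → ℝ) (k : κ) (z : κ → ℝ) : ℝ :=
  (∏ j ∈ Finset.univ.erase k, φ (z j)) * φ1 (z k)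

/-- second partial derivatives of the product function -/
noncomputable def auxV (φ φ1 φ2 : ℝ → ℝ) (k j : κ) (z : κ → ℝ) : ℝ :=
  if j = k then (∏ j ∈ Finset.univ.erase k, φ (z j)) * φ2 (z k)
  else (∏ i ∈ (Finset.univ.erase k).erase j, φ (z i)) * φ1 (z j) * φ1 (z k)

/-- the linear map attached to a family of vectors -/
noncomputable def auxZ (c : κ → ι → ℝ) (x : ι → ℝ) (k : κ) : ℝ := ∑ i, c k i * x i

/-- hypotheses on the smooth cutoff -/
structure AuxCut (φ φ1 φ2 : ℝ → ℝ) (C : ℝ) : Prop where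
  d1 : ∀ x, HasDerivAt φ (φ1 x) x
  d2 : ∀ x, HasDerivAt φ1 (φ2 x) x
  c2 : Continuous φ2
  n0 : ∀ x, 0 ≤ φ x
  l0 : ∀ x, φ x ≤ 1
  n1 : ∀ x, φ1 x ≤ 0
  b1 : ∀ x, |φ1 x| ≤ C
  b2 : ∀ x, |φ2 x| ≤ C
  hC : 1 ≤ C

variable {φ φ1 φ2 : ℝ → ℝ} {C : ℝ}

lemma AuxCut.c0 (h : AuxCut φ φ1 φ2 C) : Continuous φ :=
  continuous_iff_continuousAt.2 fun x => (h.d1 x).continuousAt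

lemma AuxCut.c1 (h : AuxCut φ φ1 φ2 C) : Continuous φ1 :=
  continuous_iff_continuousAt.2 fun x => (h.d2 x).continuousAt

lemma AuxCut.prod_nonneg (h : AuxCut φ φ1 φ2 C) (s : Finset κ) (z : κ → ℝ) :
    0 ≤ ∏ j ∈ s, φ (z j) := Finset.prod_nonneg fun _ _ => h.n0 _

lemma AuxCut.prod_le (h : AuxCut φ φ1 φ2 C) (s : Finset κ) (z : κ → ℝ) :
    ∏ j ∈ s, φ (z j) ≤ 1 := Finset.prod_le_one (fun _ _ => h.n0 _) fun _ _ => h.l0 _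

lemma AuxCut.prod_mul_le (h : AuxCut φ φ1 φ2 C) (s : Finset κ) (z : κ → ℝ) {a D : ℝ}
    (ha : |a| ≤ D) : |(∏ j ∈ s, φ (z j)) * a| ≤ D := by
  rw [abs_mul, abs_of_nonneg (h.prod_nonneg s z)]
  calc _ ≤ 1 * |a| := mul_le_mul_of_nonneg_right (h.prod_le s z) (abs_nonneg _)
    _ ≤ D := by simpa using ha

lemma AuxCut.U_le (h : AuxCut φ φ1 φ2 C) (k : κ) (z : κ → ℝ) : |auxU φ φ1 k z| ≤ C :=
  h.prod_mul_le _ _ (h.b1 _)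

lemma AuxCut.V_le (h : AuxCut φ φ1 φ2 C) (k j : κ) (z : κ → ℝ) :
    |auxV φ φ1 φ2 k j z| ≤ C * C := by
  have hC := h.hC
  unfold auxV
  split_ifs
  · exact h.prod_mul_le _ _ ((h.b2 _).trans (by nlinarith))
  · rw [mul_assoc]
    refine h.prod_mul_le _ _ ?_
    rw [abs_mul]
    exact mul_le_mul (h.b1 _) (h.b1 _) (abs_nonneg _) (by linarith)

lemma AuxCut.V_nonneg (h : AuxCut φ φ1 φ2 C) {k j : κ} (hkj : j ≠ k) (z : κ → ℝ) :
    0 ≤ auxV φ φ1 φ2 k j z := by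
  unfold auxV
  rw [if_neg hkj, mul_assoc]
  exact mul_nonneg (h.prod_nonneg _ _) (mul_nonneg_of_nonpos_of_nonpos (h.n1 _) (h.n1 _))

lemma AuxCut.U_cont (h : AuxCut φ φ1 φ2 C) (k : κ) : Continuous (auxU φ φ1 k) := by
  have := h.c0
  have := h.c1
  unfold auxU
  fun_prop

lemma AuxCut.V_cont (h : AuxCut φ φ1 φ2 C) (k j : κ) : Continuous (auxV φ φ1 φ2 k j) := by
  have := h.c0
  have := h.c1
  have := h.c2
  unfold auxV
  split_ifs <;> fun_prop

lemma auxZ_cont (c : κ → ι → ℝ) : Continuous (auxZ c) := by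
  unfold auxZ
  fun_prop

lemma AuxCut.dF (h : AuxCut φ φ1 φ2 C) {z : ℝ → κ → ℝ} {z' : κ → ℝ} {s : ℝ}
    (hz : ∀ k, HasDerivAt (fun s => z s k) (z' k) s) :
    HasDerivAt (fun s => ∏ k, φ (z s k)) (∑ k, auxU φ φ1 k (z s) * z' k) s := by
  have := HasDerivAt.fun_finsetProd (u := (Finset.univ : Finset κ))
    (f := fun k s => φ (z s k)) (f' := fun k => φ1 (z s k) * z' k) (x := s)
    (fun k _ => (h.d1 (z s k)).comp s (hz k))
  refine this.congr_deriv ?_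
  symm
  refine Finset.sum_congr (M := ℝ) rfl fun k _ => ?_
  simp only [auxU, smul_eq_mul]; ring

lemma AuxCut.dU (h : AuxCut φ φ1 φ2 C) {z : ℝ → κ → ℝ} {z' : κ → ℝ} {s : ℝ} (k : κ)
    (hz : ∀ k, HasDerivAt (fun s => z s k) (z' k) s) :
    HasDerivAt (fun s => auxU φ φ1 k (z s)) (∑ j, auxV φ φ1 φ2 k j (z s) * z' j) s := by
  have h1 := HasDerivAt.fun_finsetProd (u := (Finset.univ.erase k : Finset κ))
    (f := fun k s => φ (z s k)) (f' := fun k => φ1 (z s k) * z' k) (x := s)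
    (fun k _ => (h.d1 (z s k)).comp s (hz k))
  have h2 : HasDerivAt (fun s => φ1 (z s k)) (φ2 (z s k) * z' k) s :=
    (h.d2 (z s k)).comp s (hz k)
  have := h1.mul h2
  refine this.congr_deriv ?_
  symm
  rw [← Finset.add_sum_erase Finset.univ (fun j => auxV φ φ1 φ2 k j (z s) * z' j)
    (Finset.mem_univ k), add_comm, Finset.sum_mul]
  congr 1
  · refine Finset.sum_congr rfl fun j hj => ?_
    simp only [auxV, if_neg (Finset.ne_of_mem_erase hj), smul_eq_mul]; ring
  · simp only [auxV, if_true]; ring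

lemma auxZ_update (c : κ → ι → ℝ) (x : ι → ℝ) (i : ι) (s : ℝ) (k : κ) :
    HasDerivAt (fun s => auxZ c (Function.update x i s) k) (c k i) s := by
  have : (fun s => auxZ c (Function.update x i s) k)
      = fun s => c k i * s + ∑ j ∈ Finset.univ.erase i, c k j * x j := by
    ext s
    unfold auxZ
    rw [← Finset.add_sum_erase _ _ (Finset.mem_univ i), Function.update_self]
    congr 1
    refine Finset.sum_congr rfl fun j hj => ?_
    rw [Function.update_of_ne (Finset.ne_of_mem_erase hj)]
  rw [this]
  exact ((((hasDerivAt_id s).const_mul (c k i)).add_const _).congr_deriv (mul_one _))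

lemma AuxCut.ibp (h : AuxCut φ φ1 φ2 C) (c : κ → ι → ℝ) (k : κ) (i : ι) :
    ∫ x, x i * auxU φ φ1 k (auxZ c x) ∂(Measure.pi fun _ : ι => gaussianReal 0 1)
      = ∑ j, c j i * ∫ x, auxV φ φ1 φ2 k j (auxZ c x)
        ∂(Measure.pi fun _ : ι => gaussianReal 0 1) := by
  have hC := h.hC
  have hVc : ∀ j, Continuous fun x : ι → ℝ => auxV φ φ1 φ2 k j (auxZ c x) :=
    fun j => (h.V_cont k j).comp (auxZ_cont c)
  have hS : 0 ≤ ∑ j, C * C * |c j i| := Finset.sum_nonneg fun j _ => by positivity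
  rw [aux_ibp i (G := fun x => auxU φ φ1 k (auxZ c x))
    (G' := fun x => ∑ j, auxV φ φ1 φ2 k j (auxZ c x) * c j i)
    (C := C + ∑ j, C * C * |c j i|) ((h.U_cont k).comp (auxZ_cont c))
    (by fun_prop) (fun x s => h.dU k fun j => auxZ_update c x i s j)
    (fun x => (h.U_le k _).trans (by linarith))
    (fun x => ?_)]
  · rw [integral_finsetSum]
    · refine Finset.sum_congr rfl fun j _ => ?_
      rw [integral_mul_const, mul_comm]
    · intro j _
      refine Integrable.mul_const ?_ _
      exact Integrable.of_bound (hVc j).aestronglyMeasurable (C * C)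
        (Filter.Eventually.of_forall fun x => h.V_le k j _)
  · refine (Finset.abs_sum_le_sum_abs _ _).trans ?_
    have : ∑ j, |auxV φ φ1 φ2 k j (auxZ c x) * c j i| ≤ ∑ j, C * C * |c j i| :=
      Finset.sum_le_sum fun j _ => by
        rw [abs_mul]; exact mul_le_mul_of_nonneg_right (h.V_le k j _) (abs_nonneg _)
    linarith

lemma AuxCut.deriv_nonneg (h : AuxCut φ φ1 φ2 C) (c c' : κ → ι → ℝ)
    (h0 : ∀ k, ∑ i, c' k i * c k i = 0) (h1 : ∀ k j, j ≠ k → 0 ≤ ∑ i, c' k i * c j i) :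
    0 ≤ ∫ x, ∑ k, auxU φ φ1 k (auxZ c x) * auxZ c' x k
      ∂(Measure.pi fun _ : ι => gaussianReal 0 1) := by
  have hI : ∀ k i, Integrable (fun x : ι → ℝ => x i * auxU φ φ1 k (auxZ c x))
      (Measure.pi fun _ : ι => gaussianReal 0 1) := fun k i =>
    (aux_integrable_coord i).mul_bdd ((h.U_cont k).comp (auxZ_cont c)).aestronglyMeasurable
      (Filter.Eventually.of_forall fun x => h.U_le k _)
  have e1 : (fun x : ι → ℝ => ∑ k, auxU φ φ1 k (auxZ c x) * auxZ c' x k)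
      = fun x => ∑ k, ∑ i, c' k i * (x i * auxU φ φ1 k (auxZ c x)) := by
    ext x
    refine Finset.sum_congr rfl fun k _ => ?_
    rw [auxZ, Finset.mul_sum]
    exact Finset.sum_congr rfl fun i _ => by ring
  rw [e1, integral_finsetSum _ fun k _ => integrable_finsetSum _ fun i _ => (hI k i).const_mul _]
  refine Finset.sum_nonneg fun k _ => ?_
  rw [integral_finsetSum _ fun i _ => (hI k i).const_mul _]
  simp_rw [integral_const_mul, h.ibp, Finset.mul_sum]
  rw [Finset.sum_comm]
  refine Finset.sum_nonneg fun j _ => ?_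
  simp_rw [← mul_assoc]
  rw [← Finset.sum_mul]
  by_cases hj : j = k
  · subst hj; rw [h0]; simp
  · exact mul_nonneg (h1 k j hj) (integral_nonneg fun x => h.V_nonneg hj _)

/-- interpolating family of vectors -/
noncomputable def auxC (p q : ℝ) (a b : κ → ι → ℝ) (k : κ) : ι ⊕ ι → ℝ :=
  Sum.elim (fun i => p * a k i) (fun i => q * b k i)

lemma auxC_inner (p q p' q' : ℝ) (a b : κ → ι → ℝ) (k j : κ) :
    ∑ i, auxC p' q' a b k i * auxC p q a b j i
      = p' * p * (∑ i, a k i * a j i) + q' * q * (∑ i, b k i * b j i) := by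
  rw [Fintype.sum_sum_type, Finset.mul_sum, Finset.mul_sum]
  congr 1 <;> refine Finset.sum_congr rfl fun i _ => ?_ <;> simp only [auxC, Sum.elim_inl,
    Sum.elim_inr] <;> ring

lemma auxZ_auxC (p q : ℝ) (a b : κ → ι → ℝ) (x : ι ⊕ ι → ℝ) (k : κ) :
    auxZ (auxC p q a b) x k = p * auxZ a (fun i => x (Sum.inl i)) k
      + q * auxZ b (fun i => x (Sum.inr i)) k := by
  unfold auxZ
  rw [Fintype.sum_sum_type, Finset.mul_sum, Finset.mul_sum]
  congr 1 <;> refine Finset.sum_congr rfl fun i _ => ?_ <;> simp only [auxC, Sum.elim_inl,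
    Sum.elim_inr] <;> ring

lemma AuxCut.hasDeriv (h : AuxCut φ φ1 φ2 C) (a b : κ → ι → ℝ) (θ : ℝ) :
    HasDerivAt (fun θ => ∫ x, ∏ k, φ (auxZ (auxC (Real.cos θ) (Real.sin θ) a b) x k)
        ∂(Measure.pi fun _ : ι ⊕ ι => gaussianReal 0 1))
      (∫ x, ∑ k, auxU φ φ1 k (auxZ (auxC (Real.cos θ) (Real.sin θ) a b) x)
          * auxZ (auxC (-Real.sin θ) (Real.cos θ) a b) x k
        ∂(Measure.pi fun _ : ι ⊕ ι => gaussianReal 0 1)) θ := by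
  have hC := h.hC
  have hc0 := h.c0
  have hFc : ∀ c : κ → ι ⊕ ι → ℝ, Continuous fun x => ∏ k, φ (auxZ c x k) := fun c => by
    have := auxZ_cont c
    fun_prop
  refine (hasDerivAt_integral_of_dominated_loc_of_deriv_le (s := Set.univ)
    (F' := fun θ x => ∑ k, auxU φ φ1 k (auxZ (auxC (Real.cos θ) (Real.sin θ) a b) x)
          * auxZ (auxC (-Real.sin θ) (Real.cos θ) a b) x k)
    (bound := fun x => ∑ k, C * ∑ i, |auxC 1 1 a b k i| * |x i|)
    Filter.univ_mem ?_ ?_ ?_ ?_ ?_ ?_).2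
  · exact Filter.Eventually.of_forall fun θ => (hFc _).aestronglyMeasurable
  · refine Integrable.of_bound (hFc _).aestronglyMeasurable 1 (Filter.Eventually.of_forall
      fun x => ?_)
    rw [Real.norm_eq_abs, abs_of_nonneg (h.prod_nonneg _ _)]
    exact h.prod_le _ _
  · refine Continuous.aestronglyMeasurable ?_
    have h1 := auxZ_cont (auxC (Real.cos θ) (Real.sin θ) a b)
    have h2 := auxZ_cont (auxC (-Real.sin θ) (Real.cos θ) a b)
    have h3 := fun k : κ => (h.U_cont k).comp h1
    exact continuous_finsetSum _ fun k _ => (h3 k).mul ((continuous_apply k).comp h2)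
  · refine Filter.Eventually.of_forall fun x θ _ => ?_
    rw [Real.norm_eq_abs]
    refine (Finset.abs_sum_le_sum_abs _ _).trans (Finset.sum_le_sum fun k _ => ?_)
    rw [abs_mul]
    refine mul_le_mul (h.U_le k _) ?_ (abs_nonneg _) (by linarith)
    unfold auxZ
    refine (Finset.abs_sum_le_sum_abs _ _).trans (Finset.sum_le_sum fun i _ => ?_)
    rw [abs_mul]
    refine mul_le_mul_of_nonneg_right ?_ (abs_nonneg _)
    cases i with
    | inl i =>
      simp only [auxC, Sum.elim_inl, abs_mul, abs_neg, abs_one]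
      exact mul_le_mul_of_nonneg_right (Real.abs_sin_le_one θ) (abs_nonneg _)
    | inr i =>
      simp only [auxC, Sum.elim_inr, abs_mul, abs_one]
      exact mul_le_mul_of_nonneg_right (Real.abs_cos_le_one θ) (abs_nonneg _)
  · exact integrable_finsetSum _ fun k _ => (integrable_finsetSum _ fun i _ =>
      (aux_integrable_coord i).abs.const_mul _).const_mul _
  · refine Filter.Eventually.of_forall fun x θ _ => ?_
    refine h.dF (z := fun θ => auxZ (auxC (Real.cos θ) (Real.sin θ) a b) x) fun k => ?_
    simp only [auxZ_auxC]
    exact ((Real.hasDerivAt_cos θ).mul_const _).add ((Real.hasDerivAt_sin θ).mul_const _)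

lemma AuxCut.compare (h : AuxCut φ φ1 φ2 C) (a b : κ → ι → ℝ)
    (h0 : ∀ k, ∑ i, a k i * a k i = ∑ i, b k i * b k i)
    (h1 : ∀ k j, ∑ i, a k i * a j i ≤ ∑ i, b k i * b j i) :
    ∫ x, ∏ k, φ (auxZ a x k) ∂(Measure.pi fun _ : ι => gaussianReal 0 1)
      ≤ ∫ x, ∏ k, φ (auxZ b x k) ∂(Measure.pi fun _ : ι => gaussianReal 0 1) := by
  have hc0 := h.c0
  have hFc : ∀ c : κ → ι → ℝ, Continuous fun x => ∏ k, φ (auxZ c x k) := fun c => by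
    have := auxZ_cont c
    fun_prop
  have mono : MonotoneOn (fun θ => ∫ x, ∏ k, φ (auxZ (auxC (Real.cos θ) (Real.sin θ) a b) x k)
        ∂(Measure.pi fun _ : ι ⊕ ι => gaussianReal 0 1)) (Set.Icc 0 (Real.pi / 2)) := by
    refine monotoneOn_of_deriv_nonneg (convex_Icc _ _)
      (fun θ _ => (h.hasDeriv a b θ).continuousAt.continuousWithinAt)
      (fun θ _ => (h.hasDeriv a b θ).differentiableAt.differentiableWithinAt) fun θ hθ => ?_
    rw [interior_Icc] at hθ
    rw [(h.hasDeriv a b θ).deriv]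
    have hs : 0 ≤ Real.sin θ := Real.sin_nonneg_of_nonneg_of_le_pi hθ.1.le
      (by linarith [hθ.2, Real.pi_pos])
    have hc : 0 ≤ Real.cos θ := Real.cos_nonneg_of_neg_pi_div_two_le_of_le
      (by linarith [hθ.1, Real.pi_pos]) hθ.2.le
    refine h.deriv_nonneg _ _ (fun k => ?_) (fun k j _ => ?_)
    · rw [auxC_inner, h0]; ring
    · rw [auxC_inner]
      nlinarith [mul_nonneg (mul_nonneg hs hc) (sub_nonneg.2 (h1 k j))]
  have hpi := Real.pi_pos
  have := mono (Set.left_mem_Icc.2 (by positivity)) (Set.right_mem_Icc.2 (by positivity))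
    (by positivity)
  simp only [Real.cos_zero, Real.sin_zero, Real.cos_pi_div_two, Real.sin_pi_div_two, auxZ_auxC,
    one_mul, zero_mul, add_zero, zero_add] at this
  have mp := measurePreserving_sumPiEquivProdPi (X := fun _ : ι ⊕ ι => ℝ)
    (fun _ => gaussianReal 0 1)
  have m1 : MeasurePreserving (fun (x : ι ⊕ ι → ℝ) i => x (Sum.inl i))
      (Measure.pi fun _ : ι ⊕ ι => gaussianReal 0 1) (Measure.pi fun _ : ι => gaussianReal 0 1) :=
    measurePreserving_fst.comp mp
  have m2 : MeasurePreserving (fun (x : ι ⊕ ι → ℝ) i => x (Sum.inr i))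
      (Measure.pi fun _ : ι ⊕ ι => gaussianReal 0 1) (Measure.pi fun _ : ι => gaussianReal 0 1) :=
    measurePreserving_snd.comp mp
  rw [← m1.map_eq, integral_map m1.measurable.aemeasurable (hFc a).aestronglyMeasurable]
  refine this.trans_eq ?_
  rw [m1.map_eq, ← m2.map_eq,
    integral_map m2.measurable.aemeasurable (hFc b).aestronglyMeasurable]

end Smooth

/-- the explicit cutoff -/
noncomputable def auxPhi (t : ℝ) (n : ℕ) (s : ℝ) : ℝ :=
  Real.sigmoid ((n + 1 : ℝ) - (n + 1 : ℝ) ^ 2 * (s - t))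

lemma auxPhi_cut (t : ℝ) (n : ℕ) : ∃ φ1 φ2 C, AuxCut (auxPhi t n) φ1 φ2 C := by
  set N : ℝ := (n + 1 : ℝ) ^ 2 with hN
  have hN1 : 1 ≤ N := by rw [hN]; nlinarith [(Nat.cast_nonneg n : (0 : ℝ) ≤ n)]
  have d1 : ∀ x, HasDerivAt (auxPhi t n) (-N * (auxPhi t n x * (1 - auxPhi t n x))) x := by
    intro x
    have hl : HasDerivAt (fun s : ℝ => (n + 1 : ℝ) - N * (s - t)) (-N) x :=
      (((((hasDerivAt_id x).sub_const t).const_mul N).const_sub (n + 1 : ℝ))).congr_deriv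
        (by ring)
    exact ((Real.hasDerivAt_sigmoid _).comp x hl).congr_deriv (by simp only [auxPhi]; ring)
  have n0 : ∀ x, 0 ≤ auxPhi t n x := fun x => Real.sigmoid_nonneg _
  have l0 : ∀ x, auxPhi t n x ≤ 1 := fun x => Real.sigmoid_le_one _
  have hc : Continuous (auxPhi t n) :=
    continuous_iff_continuousAt.2 fun x => (d1 x).continuousAt
  refine ⟨fun x => -N * (auxPhi t n x * (1 - auxPhi t n x)),
    fun x => N ^ 2 * ((auxPhi t n x * (1 - auxPhi t n x)) * (1 - 2 * auxPhi t n x)), N ^ 2,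
    ⟨d1, ?_, ?_, n0, l0, ?_, ?_, ?_, ?_⟩⟩
  · intro x
    exact (((d1 x).mul ((d1 x).const_sub 1)).const_mul (-N)).congr_deriv (by ring)
  · fun_prop
  · intro x
    have := mul_nonneg (n0 x) (sub_nonneg.2 (l0 x))
    show -N * (auxPhi t n x * (1 - auxPhi t n x)) ≤ 0
    nlinarith
  · intro x
    have := mul_nonneg (n0 x) (sub_nonneg.2 (l0 x))
    have h2 : auxPhi t n x * (1 - auxPhi t n x) ≤ 1 := by nlinarith [n0 x, l0 x]
    show |-N * (auxPhi t n x * (1 - auxPhi t n x))| ≤ N ^ 2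
    rw [abs_mul, abs_neg, abs_of_nonneg this, abs_of_nonneg (by linarith)]
    nlinarith
  · intro x
    have := mul_nonneg (n0 x) (sub_nonneg.2 (l0 x))
    have h2 : auxPhi t n x * (1 - auxPhi t n x) ≤ 1 := by nlinarith [n0 x, l0 x]
    have h3 : |1 - 2 * auxPhi t n x| ≤ 1 := abs_le.2 ⟨by linarith [l0 x], by linarith [n0 x]⟩
    show |N ^ 2 * ((auxPhi t n x * (1 - auxPhi t n x)) * (1 - 2 * auxPhi t n x))| ≤ N ^ 2
    rw [abs_mul, abs_mul, abs_of_nonneg this, abs_of_nonneg (sq_nonneg N)]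
    have := mul_le_one₀ h2 (abs_nonneg _) h3
    nlinarith [sq_nonneg N]
  · nlinarith

lemma auxPhi_tendsto (t s : ℝ) :
    Filter.Tendsto (fun n => auxPhi t n s) Filter.atTop (nhds (if s ≤ t then 1 else 0)) := by
  have hN : Filter.Tendsto (fun n : ℕ => (n + 1 : ℝ)) Filter.atTop Filter.atTop :=
    Filter.tendsto_atTop_add_const_right _ _ tendsto_natCast_atTop_atTop
  split_ifs with h
  · refine Real.tendsto_sigmoid_atTop.comp (Filter.tendsto_atTop_mono (fun n => ?_) hN)
    nlinarith [mul_nonneg (sq_nonneg (n + 1 : ℝ)) (sub_nonneg.2 h)]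
  · push Not at h
    refine Real.tendsto_sigmoid_atBot.comp ?_
    have h2 : Filter.Tendsto (fun n : ℕ => 1 - (n + 1 : ℝ) * (s - t)) Filter.atTop
        Filter.atBot := by
      have := (hN.atTop_mul_const (sub_pos.2 h))
      exact Filter.tendsto_atBot_add_const_left _ 1 (Filter.tendsto_neg_atTop_atBot.comp this)
    refine (hN.atTop_mul_atBot₀ h2).congr fun n => ?_
    ring

lemma aux_limit {κ ι : Type*} [Fintype κ] [DecidableEq κ] [Fintype ι] [DecidableEq ι]
    (a : κ → ι → ℝ) (t : ℝ) :
    Filter.Tendsto (fun n => ∫ x, ∏ k, auxPhi t n (auxZ a x k)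
        ∂(Measure.pi fun _ : ι => gaussianReal 0 1)) Filter.atTop
      (nhds ((Measure.pi fun _ : ι => gaussianReal 0 1).real {x | ∀ k, auxZ a x k ≤ t})) := by
  have hms : MeasurableSet {x : ι → ℝ | ∀ k, auxZ a x k ≤ t} := by
    have hz := auxZ_cont a
    have : IsClosed {x : ι → ℝ | ∀ k, auxZ a x k ≤ t} := by
      rw [Set.ofPred_forall]
      exact isClosed_iInter fun k => isClosed_le ((continuous_apply k).comp hz) continuous_const
    exact this.measurableSet
  rw [← integral_indicator_one hms]
  refine tendsto_integral_of_dominated_convergence (fun _ => 1) ?_ (integrable_const _) ?_ ?_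
  · intro n
    obtain ⟨φ1, φ2, C, h⟩ := auxPhi_cut t n
    have := h.c0
    have := auxZ_cont a
    exact Continuous.aestronglyMeasurable (by fun_prop)
  · intro n
    obtain ⟨φ1, φ2, C, h⟩ := auxPhi_cut t n
    refine Filter.Eventually.of_forall fun x => ?_
    rw [Real.norm_eq_abs, abs_of_nonneg (h.prod_nonneg _ _)]
    exact h.prod_le _ _
  · refine Filter.Eventually.of_forall fun x => ?_
    have := tendsto_finsetProd (Finset.univ : Finset κ)
      fun k _ => auxPhi_tendsto t (auxZ a x k)
    convert this using 2
    rw [Finset.prod_ite_zero]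
    simp [Set.indicator_apply]

lemma aux_slepian {κ ι : Type*} [Fintype κ] [DecidableEq κ] [Fintype ι] [DecidableEq ι]
    (a b : κ → ι → ℝ) (t : ℝ)
    (h0 : ∀ k, ∑ i, a k i * a k i = ∑ i, b k i * b k i)
    (h1 : ∀ k j, ∑ i, a k i * a j i ≤ ∑ i, b k i * b j i) :
    (Measure.pi fun _ : ι => gaussianReal 0 1) {x | ∀ k, ∑ i, a k i * x i ≤ t}
      ≤ (Measure.pi fun _ : ι => gaussianReal 0 1) {x | ∀ k, ∑ i, b k i * x i ≤ t} := by
  have := le_of_tendsto_of_tendsto' (aux_limit a t) (aux_limit b t) fun n => by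
    obtain ⟨φ1, φ2, C, h⟩ := auxPhi_cut t n
    exact h.compare a b h0 h1
  exact (ENNReal.toReal_le_toReal (measure_ne_top _ _) (measure_ne_top _ _)).1 this

/-- For the LSS dictionaries `D^m` and `D^{m+1}` (nonnegative unit
atoms with correlations `⟨d_i, d_j⟩ = Γ(τ_i − τ_j)`, `Γ` non-increasing in `|u|`,
`Γ(0) = 1`) and `ε` standard Gaussian on `ℝ^l`, for every `m ≥ 2` and `t ∈ ℝ`,
`P(z₂^{(m+1)} ≤ t, …, z_{m+1}^{(m+1)} ≤ t) ≥ P(z₁^{(m)} ≤ t, …, z_m^{(m)} ≤ t)`. -/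
theorem slepian_comparison_lss_dictionaries
    {l : ℕ} (τ : ℝ) (hτ : 0 < τ) (Γ γ : ℝ → ℝ)
    (hΓ : ∀ u, Γ u = γ |u|) (hγ : Antitone γ) (hΓ0 : Γ 0 = 1)
    (m : ℕ) (hm : 2 ≤ m)
    (d : ℕ → ℕ → Fin l → ℝ)
    (hpos : ∀ M k i, 0 ≤ d M k i)
    (hcorr : ∀ M : ℕ, (M = m ∨ M = m + 1) → ∀ i j : ℕ, i < M → j < M →
      (∑ idx, d M i idx * d M j idx)
        = Γ ((-τ + (2 * τ / ((M : ℝ) - 1)) * (i : ℝ))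
            - (-τ + (2 * τ / ((M : ℝ) - 1)) * (j : ℝ))))
    (t : ℝ) :
    (Measure.pi fun _ : Fin l => gaussianReal 0 1)
        {x | ∀ k : Fin m, (∑ i, d m (k : ℕ) i * x i) ≤ t}
      ≤ (Measure.pi fun _ : Fin l => gaussianReal 0 1)
        {x | ∀ k : Fin m, (∑ i, d (m + 1) ((k : ℕ) + 1) i * x i) ≤ t} := by
  have hm' : (0 : ℝ) < (m : ℝ) - 1 := by
    have : (2 : ℝ) ≤ m := by exact_mod_cast hm
    linarith
  refine aux_slepian (fun k : Fin m => d m k) (fun k : Fin m => d (m + 1) (k + 1)) t ?_ ?_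
  · intro k
    rw [hcorr m (Or.inl rfl) _ _ k.2 k.2,
      hcorr (m + 1) (Or.inr rfl) _ _ (by omega) (by omega), sub_self, sub_self]
  · intro k j
    rw [hcorr m (Or.inl rfl) _ _ k.2 j.2,
      hcorr (m + 1) (Or.inr rfl) _ _ (by omega) (by omega), hΓ, hΓ]
    apply hγ
    have e1 : (-τ + 2 * τ / (((m + 1 : ℕ) : ℝ) - 1) * (((k : ℕ) + 1 : ℕ) : ℝ)
        - (-τ + 2 * τ / (((m + 1 : ℕ) : ℝ) - 1) * (((j : ℕ) + 1 : ℕ) : ℝ)))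
        = 2 * τ / m * ((k : ℕ) - (j : ℕ) : ℝ) := by push_cast; ring
    have e2 : (-τ + 2 * τ / ((m : ℝ) - 1) * ((k : ℕ) : ℝ)
        - (-τ + 2 * τ / ((m : ℝ) - 1) * ((j : ℕ) : ℝ)))
        = 2 * τ / ((m : ℝ) - 1) * ((k : ℕ) - (j : ℕ) : ℝ) := by ring
    rw [e1, e2, abs_mul, abs_mul, abs_of_nonneg (show 0 ≤ 2 * τ / (m : ℝ) by positivity),
      abs_of_nonneg (show 0 ≤ 2 * τ / ((m : ℝ) - 1) by positivity)]
    refine mul_le_mul_of_nonneg_right ?_ (abs_nonneg _)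
    exact div_le_div_of_nonneg_left (by positivity) hm' (by linarith)
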